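/- Assume c < a and c < b. Then a configuration σ is a ground state if and only if σ is constant; in particular the λ-model has exactly three ground states, all translation-invariant. -/

import Mathlib

/-- Vertices of the semi-infinite Cayley tree of order 2: finite words over a
two-letter alphabet (the root is the empty word). -/
abbrev Vertex : Type := List (Fin 2)

/-- Spin configurations: the values `0, 1, 2` of `Fin 3` encode the spins `1, 2, 3`. -/
abbrev Config : Type := Vertex → Fin 3

/-- The interaction `λ`: it equals `a` if `|i - j| = 2`, `b` if `|i - j| = 1`,
and `c` if `i = j`. -/
noncomputable def lam (a b c : ℝ) (i j : Fin 3) : ℝ :=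
  if ((i : ℤ) - (j : ℤ)).natAbs = 2 then a
  else if ((i : ℤ) - (j : ℤ)).natAbs = 1 then b
  else c

/-- The ball energy `U_x(σ) = (λ(σ(x),σ(x1)) + λ(σ(x),σ(x2)))/2`. -/
noncomputable def ballEnergy (a b c : ℝ) (σ : Config) (x : Vertex) : ℝ :=
  (lam a b c (σ x) (σ (x ++ [0])) + lam a b c (σ x) (σ (x ++ [1]))) / 2

/-- `min {(α+β)/2 : α, β ∈ {a,b,c}}`. -/
noncomputable def minEnergy (a b c : ℝ) : ℝ :=
  sInf {u : ℝ | ∃ α ∈ ({a, b, c} : Set ℝ), ∃ β ∈ ({a, b, c} : Set ℝ), u = (α + β) / 2}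

/-- A configuration is a ground state if every ball energy attains the minimal value. -/
def IsGroundState (a b c : ℝ) (σ : Config) : Prop :=
  ∀ x : Vertex, ballEnergy a b c σ x = minEnergy a b c

/-- `σ` is `G_m`-periodic if `σ(g ∘ x) = σ(x)` whenever `m` divides the length of `g`. -/
def GPeriodic (m : ℕ) (σ : Config) : Prop :=
  ∀ g x : Vertex, m ∣ g.length → σ (g ++ x) = σ x

/-- `σ` is translation-invariant if `σ(g ∘ x) = σ(x)` for all words `g`. -/
def TranslationInvariant (σ : Config) : Prop :=
  ∀ g x : Vertex, σ (g ++ x) = σ x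

theorem lam_self (a b c : ℝ) (i : Fin 3) : lam a b c i i = c := by
  simp [lam]

theorem lam_lt_of_ne {a b c : ℝ} (hca : c < a) (hcb : c < b) {i j : Fin 3} (hij : i ≠ j) :
    c < lam a b c i j := by
  fin_cases i <;> fin_cases j <;> simp_all [lam]

theorem le_lam {a b c : ℝ} (hca : c < a) (hcb : c < b) (i j : Fin 3) : c ≤ lam a b c i j := by
  rcases eq_or_ne i j with rfl | hij
  · exact (lam_self a b c i).ge
  · exact (lam_lt_of_ne hca hcb hij).le

theorem minEnergy_eq {a b c : ℝ} (hca : c < a) (hcb : c < b) : minEnergy a b c = c := by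
  refine IsLeast.csInf_eq ⟨⟨c, by simp, c, by simp, by ring⟩, ?_⟩
  have hle : ∀ α ∈ ({a, b, c} : Set ℝ), c ≤ α := by
    rintro α (rfl | rfl | rfl)
    exacts [hca.le, hcb.le, le_rfl]
  rintro u ⟨α, hα, β, hβ, rfl⟩
  linarith [hle α hα, hle β hβ]

theorem ballEnergy_eq_iff {a b c : ℝ} (hca : c < a) (hcb : c < b) (σ : Config) (x : Vertex) :
    ballEnergy a b c σ x = c ↔ ∀ i : Fin 2, σ (x ++ [i]) = σ x := by
  unfold ballEnergy
  rw [Fin.forall_fin_two]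
  constructor
  · intro h
    have h0 := le_lam hca hcb (σ x) (σ (x ++ [0]))
    have h1 := le_lam hca hcb (σ x) (σ (x ++ [1]))
    constructor
    · by_contra hne
      linarith [lam_lt_of_ne hca hcb (Ne.symm hne)]
    · by_contra hne
      linarith [lam_lt_of_ne hca hcb (Ne.symm hne)]
  · rintro ⟨h0, h1⟩
    rw [h0, h1, lam_self]
    ring

theorem isGroundState_iff_const {a b c : ℝ} (hca : c < a) (hcb : c < b) (σ : Config) :
    IsGroundState a b c σ ↔ ∃ k : Fin 3, σ = fun _ => k := by
  simp only [IsGroundState, minEnergy_eq hca hcb, ballEnergy_eq_iff hca hcb]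
  constructor
  · intro h
    refine ⟨σ [], funext fun x => ?_⟩
    induction x using List.reverseRecOn with
    | nil => rfl
    | append_singleton x i ih => rw [h x i, ih]
  · rintro ⟨k, rfl⟩ x i
    rfl

/-- if `c < a` and `c < b`, then a configuration is a ground state
iff it is constant; in particular there are exactly three ground states, all
translation-invariant. -/
theorem stmt10 (a b c : ℝ) (hca : c < a) (hcb : c < b) :
    (∀ σ : Config, IsGroundState a b c σ ↔ ∃ k : Fin 3, σ = fun _ => k) ∧
    {σ : Config | IsGroundState a b c σ}.encard = 3 ∧
    (∀ σ : Config, IsGroundState a b c σ → TranslationInvariant σ) := by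
  refine ⟨isGroundState_iff_const hca hcb, ?_, fun σ hσ => ?_⟩
  · have hrange : {σ : Config | IsGroundState a b c σ} =
        Set.range (Function.const Vertex : Fin 3 → Config) := by
      ext σ
      rw [Set.mem_ofPred_eq, isGroundState_iff_const hca hcb]
      exact exists_congr fun k => eq_comm
    rw [hrange, ← Set.image_univ, Function.const_injective.encard_image, Set.encard_univ]
    simp
  · obtain ⟨k, rfl⟩ := (isGroundState_iff_const hca hcb σ).1 hσ
    exact fun _ _ => rfl
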